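/- For every nonnegative integer n, the number of square-lattice walks of length 2n that start at (0,0), end at (0,0), and are confined to the Gessel cone G = {(i,j) ∈ ℤ² : i + j ≥ 0 and j ≥ 0} equals 16^n · (1/2)_n (5/6)_n / ( (2)_n (5/3)_n ). -/

import Mathlib

/-- Square-lattice steps. -/
def squareSteps : Set (ℤ × ℤ) := {(1,0), (-1,0), (0,1), (0,-1)}

/-- Diagonal-lattice steps. -/
def diagSteps : Set (ℤ × ℤ) := {(1,1), (1,-1), (-1,1), (-1,-1)}

/-- The three-quadrant cone `C = {(i,j) : i ≥ 0 or j ≥ 0}`. -/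
def coneC : Set (ℤ × ℤ) := {p | 0 ≤ p.1 ∨ 0 ≤ p.2}

/-- The quadrant `Q = {(i,j) : i ≥ 0 and j ≥ 0}`. -/
def quadQ : Set (ℤ × ℤ) := {p | 0 ≤ p.1 ∧ 0 ≤ p.2}

/-- Number of walks of length `n` with steps in `steps`, from `a` to `b`,
confined to `region`. -/
noncomputable def walkCount (steps region : Set (ℤ × ℤ)) (a b : ℤ × ℤ) (n : ℕ) : ℕ :=
  Nat.card {w : Fin (n+1) → ℤ × ℤ //
    w 0 = a ∧ w (Fin.last n) = b ∧
    (∀ k : Fin n, w k.succ - w k.castSucc ∈ steps) ∧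
    (∀ k, w k ∈ region)}

/-- The Gessel cone `G = {(i,j) : i + j ≥ 0 and j ≥ 0}`. -/
def coneG : Set (ℤ × ℤ) := {p | 0 ≤ p.1 + p.2 ∧ 0 ≤ p.2}

/-- Ascending factorial (Pochhammer symbol) `(a)ₙ = a(a+1)⋯(a+n-1)`. -/
noncomputable def poch (a : ℚ) (n : ℕ) : ℚ := (ascPochhammer ℚ n).eval a

/-- Elimination between the critical values `α`, `β`, `γ` of the two invariants: the half
difference `g` of `α` and `β` satisfies a polynomial equation over `ℚ(t)` and determines `q`. -/
lemma critical_elimination {A : Type*} [CommRing A] [IsDomain A] [CharZero A]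
    {t q d e α β γ : A}
    (hαβ : α - β ≠ 0) (hαγ : 2 * t * α - γ ≠ 0) (hβγ : 2 * t * β - γ ≠ 0)
    (a₀ : (2 - 4 * t + t * α ^ 2 - α) * (α + t * q) - d * α = e)
    (a₁ : (2 * t * α - 1) * (α + t * q) + (2 - 4 * t + t * α ^ 2 - α) = d)
    (b₀ : (-2 - 4 * t + t * β ^ 2 - β) * (β + t * q) - d * β = e)
    (b₁ : (2 * t * β - 1) * (β + t * q) + (-2 - 4 * t + t * β ^ 2 - β) = d)
    (c₀ : (1 - γ) ^ 2 * (γ + 2 * t ^ 2 * q) - 4 * d * t * γ = 8 * t ^ 2 * e)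
    (c₁ : 2 * (γ - 1) * (γ + 2 * t ^ 2 * q) + (1 - γ) ^ 2 = 4 * d * t) :
    ∀ g, 2 * g = α - β → g * (1 + 2 * t ^ 2 * q) = 1 + 3 * t ^ 2 * g ^ 4 ∧
      27 * t ^ 4 * g ^ 8 - 18 * t ^ 2 * g ^ 4 - 1 + g ^ 2 * (1 + 16 * t ^ 2) = 0 := by
  intro g hg
  obtain ⟨x, hx⟩ : ∃ x, x = α + t * q := ⟨_, rfl⟩
  obtain ⟨y, hy⟩ : ∃ y, y = β + t * q := ⟨_, rfl⟩
  obtain ⟨z, hz⟩ : ∃ z, z = γ + 2 * t ^ 2 * q := ⟨_, rfl⟩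
  obtain ⟨s, hs⟩ : ∃ s, s = 1 + 2 * t ^ 2 * q := ⟨_, rfl⟩
  obtain ⟨f, hf⟩ : ∃ f, f = t * q * d - e := ⟨_, rfl⟩
  obtain ⟨l, hl⟩ : ∃ l, l = t ^ 3 * q ^ 2 + t * q - d := ⟨_, rfl⟩
  have hα : α = x - t * q := by rw [hx]; ring
  have hβ : β = y - t * q := by rw [hy]; ring
  have hγ : γ = z - 2 * t ^ 2 * q := by rw [hz]; ring
  subst hα hβ hγ
  have hxy : x - y ≠ 0 := by convert hαβ using 1; ring
  have hxz : 2 * t * x - z ≠ 0 := by convert hαγ using 1; ring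
  have hyz : 2 * t * y - z ≠ 0 := by convert hβγ using 1; ring
  have a₂ : 3 * t * x ^ 2 - 2 * s * x + (2 - 4 * t) + l = 0 := by
    rw [hs, hl]; linear_combination a₁
  have b₂ : 3 * t * y ^ 2 - 2 * s * y + (-2 - 4 * t) + l = 0 := by
    rw [hs, hl]; linear_combination b₁
  have c₂ : 3 * z ^ 2 - 4 * s * z + 1 + 4 * t * l = 0 := by
    rw [hs, hl]; linear_combination c₁
  have a₃ : 2 * t * x ^ 3 - s * x ^ 2 - f = 0 := by
    rw [hs, hf]; linear_combination x * a₁ - a₀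
  have b₃ : 2 * t * y ^ 3 - s * y ^ 2 - f = 0 := by
    rw [hs, hf]; linear_combination y * b₁ - b₀
  have c₃ : z ^ 3 - s * z ^ 2 - 4 * t ^ 2 * f = 0 := by
    have h2 : (2 : A) ≠ 0 := two_ne_zero
    refine mul_left_cancel₀ h2 ?_
    rw [hs, hf]; linear_combination z * c₁ - c₀
  have r₁ : 2 * t * (x ^ 2 + x * y + y ^ 2) = s * (x + y) := by
    refine mul_left_cancel₀ hxy ?_
    linear_combination a₃ - b₃
  have r₂ : 4 * t ^ 2 * y ^ 2 + 2 * t * y * z + z ^ 2 = s * (2 * t * y + z) := by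
    refine mul_left_cancel₀ hyz ?_
    linear_combination 4 * t ^ 2 * b₃ - c₃
  have r₃ : s = 2 * t * (x + y) + z := by
    refine (mul_left_cancel₀ hxz ?_).symm
    linear_combination 2 * t * r₁ - r₂
  have r₄ : z * (x + y) = -2 * t * x * y := by
    linear_combination -(x + y) * r₃ - r₁
  have r₅ : (x - y) * (2 * s - 3 * t * (x + y)) = 4 := by
    linear_combination b₂ - a₂
  have hxy' : x - y = 2 * g := by rw [hg]; ring
  have r₆ : 2 * t * g ^ 3 = x + y := by
    refine mul_left_cancel₀ (by norm_num : (4 : A) ≠ 0) ?_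
    have h : x = y + 2 * g := by linear_combination hxy'
    subst h
    linear_combination (2 * y + 2 * g) * r₅ - 4 * g * (2 * y + 2 * g) * r₃ - 4 * g * r₄
  have r₇ : g * z = 1 - t ^ 2 * g ^ 4 := by
    refine mul_left_cancel₀ (by norm_num : (4 : A) ≠ 0) ?_
    rw [hxy', r₃, ← r₆] at r₅
    linear_combination r₅
  have r₈ : g * s = 1 + 3 * t ^ 2 * g ^ 4 := by
    rw [r₃, ← r₆]
    linear_combination r₇
  refine ⟨hs ▸ r₈, ?_⟩
  have r₉ : 6 * z ^ 2 - 8 * s * z - 12 * t ^ 2 * (x ^ 2 + y ^ 2) + 8 * t * s * (x + y) =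
      -2 - 32 * t ^ 2 := by
    linear_combination 2 * c₂ - 4 * t * a₂ - 4 * t * b₂
  have r₁₀ : 2 * (x ^ 2 + y ^ 2) = (2 * t * g ^ 3) ^ 2 + (2 * g) ^ 2 := by
    rw [r₆, ← hxy']; ring
  refine mul_left_cancel₀ (two_ne_zero (α := A)) ?_
  rw [← r₆] at r₉
  linear_combination g ^ 2 * r₉ + 6 * t ^ 2 * g ^ 2 * r₁₀ - 6 * (g * z + 1 - t ^ 2 * g ^ 4) * r₇
    + 8 * (g * z) * r₈ + 8 * (1 + 3 * t ^ 2 * g ^ 4) * r₇ - 16 * t ^ 2 * g ^ 3 * r₈ * g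

lemma hypergeometric_of_parametrization {A : Type*} [CommRing A] [IsDomain A] [CharZero A]
    [Algebra ℚ A] (θ : Derivation ℚ A A) {t ν κ B : A} (ht : θ t = t)
    (hκ : κ ^ 2 = 4 * ν ^ 2 - 3) (hτ : 27 * t ^ 2 = 9 * ν ^ 4 - 8 * ν ^ 6 - ν ^ 3 * κ ^ 3)
    (hB : 9 * B = 16 * ν ^ 3 - 6 * ν * κ ^ 2 - κ ^ 3)
    (hν0 : ν ≠ 0) (hκ0 : κ ≠ 0) (hνκ : 2 * ν + κ ≠ 0) :
    3 * θ (θ B) - 2 * θ B = 16 * t ^ 2 * (3 * θ (θ B) - 4 * θ B + B) := by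
  have hnum : ∀ n : ℕ, θ (n : A) = 0 := fun n => θ.map_natCast n
  have hmul : ∀ a b : A, θ (a * b) = a * θ b + b * θ a := fun a b => by simp
  have hpow : ∀ (a : A) (n : ℕ), θ (a ^ n) = n * a ^ (n - 1) * θ a := fun a n => by
    simp [Derivation.leibniz_pow, mul_assoc]
  have h2 : θ 2 = 0 := hnum 2
  have h3 : θ 3 = 0 := hnum 3
  have h4 : θ 4 = 0 := hnum 4
  have h6 : θ 6 = 0 := hnum 6
  have h8 : θ 8 = 0 := hnum 8
  have h9 : θ 9 = 0 := hnum 9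
  have h16 : θ 16 = 0 := hnum 16
  have h27 : θ 27 = 0 := hnum 27
  have hτ' : 27 * t ^ 2 = ν ^ 3 * (ν - κ) * (2 * ν + κ) ^ 2 := by
    linear_combination hτ + 3 * ν ^ 4 * hκ
  have eκ : κ * θ κ = 4 * ν * θ ν := by
    have h := congrArg θ hκ
    simp only [hpow, map_sub, hmul, h3, h4] at h
    push_cast at h
    refine mul_left_cancel₀ (two_ne_zero (α := A)) ?_
    linear_combination h
  have eν : 3 * κ * θ ν = 2 * ν * (κ - ν) := by
    have h := congrArg θ hτ
    simp only [hpow, map_sub, hmul, h27, h8, h9, ht] at h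
    push_cast at h
    have hne : 3 * ν ^ 2 * (2 * ν + κ) ^ 2 ≠ 0 :=
      mul_ne_zero (mul_ne_zero (by norm_num) (pow_ne_zero _ hν0)) (pow_ne_zero _ hνκ)
    refine mul_left_cancel₀ hne ?_
    linear_combination 3 * h + 36 * ν ^ 3 * θ ν * hκ - 9 * ν ^ 3 * κ * eκ - 6 * hτ'
  have eB : 9 * θ B = 4 * ν * (ν - κ) * (κ + 2 * ν) := by
    have h := congrArg θ hB
    simp only [hpow, map_sub, hmul, h6, h9, h16] at h
    push_cast at h
    linear_combination h - (12 * ν + 3 * κ) * eκ - 2 * (κ + 2 * ν) * eν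
  have eBB : 27 * κ ^ 2 * θ (θ B) = 8 * ν * (ν - κ) * (κ + 2 * ν) * (κ ^ 2 + 2 * ν ^ 2) := by
    have h := congrArg θ eB
    simp only [map_sub, map_add, hmul, h2, h4, h9] at h
    linear_combination 3 * κ ^ 2 * h - 12 * (ν ^ 2 * κ + 2 * ν * κ ^ 2) * eκ
      - 4 * (κ ^ 3 + 2 * ν * κ ^ 2 + 2 * ν ^ 2 * κ + 4 * ν ^ 3) * eν
  have hne : 27 * κ ^ 2 ≠ 0 := mul_ne_zero (by norm_num) (pow_ne_zero _ hκ0)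
  refine mul_left_cancel₀ hne ?_
  linear_combination 3 * eBB - 6 * κ ^ 2 * eB
    - 16 * t ^ 2 * (3 * eBB - 12 * κ ^ 2 * eB + 3 * κ ^ 2 * hB)
    + 48 * t ^ 2 * (2 * ν - κ) * (4 * ν ^ 2 - κ ^ 2 + 3) * hκ
    + 16 * ν ^ 3 * (ν - κ) * (κ + 2 * ν) * hκ - 16 * (2 * ν - κ) * hτ'

open PowerSeries in
lemma coeff_recurrence_of_algebraic {g q : PowerSeries ℚ} (hg : constantCoeff g = 1)
    (h₁ : g * (1 + 2 * X ^ 2 * q) = 1 + 3 * X ^ 2 * g ^ 4)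
    (h₂ : 27 * X ^ 4 * g ^ 8 - 18 * X ^ 2 * g ^ 4 - 1 + g ^ 2 * (1 + 16 * X ^ 2) = 0) (k : ℕ) :
    ((k : ℚ) + 2) * (k + 5 / 3) * coeff (2 * (k + 1)) q =
      16 * (k + 1 / 2) * (k + 5 / 6) * coeff (2 * k) q := by
  obtain ⟨ν, hν⟩ : ∃ ν, ν = g⁻¹ := ⟨_, rfl⟩
  have hgν : g * ν = 1 := by rw [hν]; exact PowerSeries.mul_inv_cancel _ (by simp [hg])
  have hν1 : constantCoeff ν = 1 := by simp [hν, hg]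
  obtain ⟨Δ, hΔ⟩ : ∃ Δ, Δ = 4 * ν ^ 2 - 3 := ⟨_, rfl⟩
  have hΔ1 : constantCoeff Δ = 1 := by
    simp only [hΔ, map_sub, map_mul, map_pow, hν1, map_ofNat]; norm_num
  have hΔi : Δ * Δ⁻¹ = 1 := PowerSeries.mul_inv_cancel _ (by simp [hΔ1])
  obtain ⟨κ, hκ⟩ : ∃ κ, κ = (9 * ν ^ 4 - 8 * ν ^ 6 - 27 * X ^ 2) * g ^ 3 * Δ⁻¹ := ⟨_, rfl⟩
  have hκ1 : constantCoeff κ = 1 := by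
    simp only [hκ, map_sub, map_mul, map_pow, hν1, hg, map_ofNat, constantCoeff_X,
      constantCoeff_inv, hΔ1]
    norm_num
  have hne : ∀ {f : PowerSeries ℚ}, constantCoeff f ≠ 0 → f ≠ 0 := by
    rintro f hf rfl
    simp at hf
  have hΔ0 : Δ ≠ 0 := hne (by simp [hΔ1])
  have hν0 : ν ≠ 0 := hne (by simp [hν1])
  have hκΔ : κ * Δ * ν ^ 3 = 9 * ν ^ 4 - 8 * ν ^ 6 - 27 * X ^ 2 := by
    calc κ * Δ * ν ^ 3
        = (9 * ν ^ 4 - 8 * ν ^ 6 - 27 * X ^ 2) * (g * ν) ^ 3 * (Δ * Δ⁻¹) := by rw [hκ]; ring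
      _ = _ := by rw [hgν, hΔi]; ring
  have hquad : 27 * X ^ 4 - 18 * X ^ 2 * ν ^ 4 - ν ^ 8 + ν ^ 6 * (1 + 16 * X ^ 2) = 0 := by
    calc 27 * X ^ 4 - 18 * X ^ 2 * ν ^ 4 - ν ^ 8 + ν ^ 6 * (1 + 16 * X ^ 2)
        = 27 * X ^ 4 * (g * ν) ^ 8 - 18 * X ^ 2 * ((g * ν) ^ 4 * ν ^ 4) - ν ^ 8
            + (g * ν) ^ 2 * ν ^ 6 * (1 + 16 * X ^ 2) := by rw [hgν]; ring
      _ = (27 * X ^ 4 * g ^ 8 - 18 * X ^ 2 * g ^ 4 - 1 + g ^ 2 * (1 + 16 * X ^ 2)) * ν ^ 8 := by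
          ring
      _ = 0 := by rw [h₂, zero_mul]
  have hκ2 : κ ^ 2 = Δ := by
    refine mul_left_cancel₀ (mul_ne_zero (pow_ne_zero 2 hΔ0) (pow_ne_zero 6 hν0)) ?_
    calc Δ ^ 2 * ν ^ 6 * κ ^ 2 = (κ * Δ * ν ^ 3) ^ 2 := by ring
      _ = Δ ^ 2 * ν ^ 6 * Δ := by rw [hκΔ, hΔ]; linear_combination 27 * hquad
  have hτ : 27 * X ^ 2 = 9 * ν ^ 4 - 8 * ν ^ 6 - ν ^ 3 * κ ^ 3 := by
    linear_combination hκΔ + κ * ν ^ 3 * hκ2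
  have hB : 9 * (1 + 2 * X ^ 2 * q) = 16 * ν ^ 3 - 6 * ν * κ ^ 2 - κ ^ 3 := by
    have hB' : (1 + 2 * X ^ 2 * q) * ν ^ 3 = ν ^ 4 + 3 * X ^ 2 := by
      have h4 : (g * ν) ^ 4 = 1 := by rw [hgν, one_pow]
      linear_combination ν ^ 4 * h₁ + 3 * X ^ 2 * h4 - (1 + 2 * X ^ 2 * q) * ν ^ 3 * hgν
    refine mul_left_cancel₀ (pow_ne_zero 3 hν0) ?_
    linear_combination 9 * hB' + hτ + 6 * ν ^ 4 * (hκ2.trans hΔ)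
  obtain ⟨θ, hθ⟩ : ∃ θ : Derivation ℚ (PowerSeries ℚ) (PowerSeries ℚ),
      θ = (X : PowerSeries ℚ) • PowerSeries.derivative ℚ := ⟨_, rfl⟩
  have hθX : θ X = X := by simp [hθ]
  have hθc : ∀ (f : PowerSeries ℚ) (n : ℕ), coeff n (θ f) = n * coeff n f := by
    intro f n
    rw [hθ, Derivation.smul_apply, smul_eq_mul]
    cases n with
    | zero => simp
    | succ n =>
      rw [coeff_succ_X_mul, coeff_derivative]
      push_cast
      ring
  have : CharZero (PowerSeries ℚ) := algebraRat.charZero _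
  have main := hypergeometric_of_parametrization θ hθX (hκ2.trans hΔ) hτ hB hν0
    (hne (by simp [hκ1])) (hne (by
      simp only [map_add, map_mul, map_ofNat, hν1, hκ1]; norm_num))
  have hq : ∀ n, coeff (n + 2) (1 + 2 * X ^ 2 * q) = 2 * coeff n q := by
    intro n
    have h : (1 + 2 * X ^ 2 * q : PowerSeries ℚ) = 1 + C 2 * (X ^ 2 * q) := by
      rw [map_ofNat]; ring
    rw [h, map_add, coeff_C_mul, coeff_X_pow_mul]
    simp [coeff_one]
  generalize (1 + 2 * X ^ 2 * q : PowerSeries ℚ) = B at *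
  have main' : C 3 * θ (θ B) - C 2 * θ B =
      C 16 * (X ^ 2 * (C 3 * θ (θ B) - C 4 * θ B + B)) := by
    simp only [map_ofNat]
    linear_combination main
  have key := congrArg (coeff (2 * k + 2 + 2)) main'
  simp only [map_sub, map_add, coeff_C_mul, coeff_X_pow_mul, hθc, hq] at key
  rw [show 2 * (k + 1) = 2 * k + 2 by ring]
  push_cast at key
  linear_combination key / 24

/-- The four lattice steps, as a finset. -/
def stepFinset : Finset (ℤ × ℤ) := {(1,0), (-1,0), (0,1), (0,-1)}

instance : DecidablePred (· ∈ coneG) := fun p =>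
  inferInstanceAs (Decidable (0 ≤ p.1 + p.2 ∧ 0 ≤ p.2))

/-- The walks of length `n` in the Gessel cone that go from the origin to `b`. -/
def coneWalks : (n : ℕ) → ℤ × ℤ → Finset (Fin (n + 1) → ℤ × ℤ)
  | 0, b => if b = 0 then {fun _ => 0} else ∅
  | n + 1, b => if b ∈ coneG then
      stepFinset.biUnion fun s =>
        (coneWalks n (b - s)).image fun w => (Fin.snoc w b : Fin (n + 2) → ℤ × ℤ)
    else ∅

lemma mem_coneWalks (n : ℕ) (b : ℤ × ℤ) (w : Fin (n + 1) → ℤ × ℤ) :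
    w ∈ coneWalks n b ↔ w 0 = (0, 0) ∧ w (Fin.last n) = b ∧
      (∀ k : Fin n, w k.succ - w k.castSucc ∈ squareSteps) ∧ (∀ k, w k ∈ coneG) := by
  induction n generalizing b with
  | zero =>
    simp only [coneWalks]
    constructor
    · intro h
      split_ifs at h with hb
      · simp only [Finset.mem_singleton] at h
        subst h hb
        simp [coneG, Prod.ext_iff]
      · simp at h
    · rintro ⟨h0, h1, -, -⟩
      have hb : b = 0 := h1.symm.trans h0
      rw [if_pos hb, Finset.mem_singleton]
      funext k
      rw [Fin.fin_one_eq_zero k]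
      exact h0
  | succ n ih =>
    have hstep : ∀ s : ℤ × ℤ, s ∈ stepFinset ↔ s ∈ squareSteps := by
      intro s
      simp [stepFinset, squareSteps]
    simp only [coneWalks]
    constructor
    · intro h
      split_ifs at h with hb
      · simp only [Finset.mem_biUnion, Finset.mem_image] at h
        obtain ⟨s, hs, w', hw', rfl⟩ := h
        obtain ⟨h0, h1, h2, h3⟩ := (ih _ _).1 hw'
        refine ⟨?_, by simp, ?_, ?_⟩
        · rw [← Fin.castSucc_zero, Fin.snoc_castSucc, h0]
        · intro k
          refine Fin.lastCases ?_ (fun j => ?_) k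
          · rw [Fin.succ_last, Fin.snoc_last, Fin.snoc_castSucc, h1, ← hstep]
            simpa using hs
          · rw [← Fin.castSucc_succ, Fin.snoc_castSucc, Fin.snoc_castSucc]
            exact h2 j
        · intro k
          refine Fin.lastCases ?_ (fun j => ?_) k
          · simpa using hb
          · rw [Fin.snoc_castSucc]
            exact h3 j
      · simp at h
    · rintro ⟨h0, h1, h2, h3⟩
      have hb : b ∈ coneG := h1 ▸ h3 _
      rw [if_pos hb]
      simp only [Finset.mem_biUnion, Finset.mem_image]
      refine ⟨w (Fin.last n).succ - w (Fin.last n).castSucc, (hstep _).2 (h2 _), Fin.init w,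
        (ih _ _).2 ⟨h0, ?_, ?_, ?_⟩, ?_⟩
      · rw [Fin.succ_last, h1]
        simp [Fin.init]
      · intro k
        exact h2 k.castSucc
      · intro k
        exact h3 _
      · rw [← h1]
        exact Fin.snoc_init_self w

lemma walkCount_eq_card (n : ℕ) (b : ℤ × ℤ) :
    walkCount squareSteps coneG (0, 0) b n = (coneWalks n b).card :=
  Nat.subtype_card _ (mem_coneWalks n b)

lemma card_coneWalks_succ (n : ℕ) (b : ℤ × ℤ) :
    (coneWalks (n + 1) b).card =
      if b ∈ coneG then ∑ s ∈ stepFinset, (coneWalks n (b - s)).card else 0 := by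
  simp only [coneWalks]
  split_ifs with hb
  · rw [Finset.card_biUnion]
    · refine Finset.sum_congr rfl fun s _ => Finset.card_image_of_injective _ fun w w' h => ?_
      simpa using congrArg Fin.init h
    · intro s _ s' _ hss
      rw [Function.onFun, Finset.disjoint_left]
      intro w hw hw'
      simp only [Finset.mem_image] at hw hw'
      obtain ⟨v, hv, rfl⟩ := hw
      obtain ⟨v', hv', h⟩ := hw'
      have hvv : v' = v := by simpa using congrArg Fin.init h
      subst hvv
      have h1 := ((mem_coneWalks _ _ _).1 hv).2.1
      have h2 := ((mem_coneWalks _ _ _).1 hv').2.1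
      exact hss (sub_right_injective (h1.symm.trans h2))
  · rfl

/-- The number of walks of length `n` in the cone ending at abscissa `a - b` and ordinate `b`; in
the coordinates `(a, b)` the cone is the quadrant and the steps are `±(1, 0)`, `±(1, 1)`. -/
def quadrantCount (n : ℕ) (a b : ℤ) : ℚ := (coneWalks n (a - b, b)).card

lemma quadrantCount_zero (a b : ℤ) :
    quadrantCount 0 a b = if a = 0 ∧ b = 0 then 1 else 0 := by
  have h : ((a - b, b) : ℤ × ℤ) = 0 ↔ a = 0 ∧ b = 0 := by
    rw [Prod.ext_iff]
    simp only [Prod.fst_zero, Prod.snd_zero]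
    omega
  simp only [quadrantCount, coneWalks, h]
  split_ifs <;> simp

lemma quadrantCount_succ (n : ℕ) (a b : ℤ) :
    quadrantCount (n + 1) a b = if 0 ≤ a ∧ 0 ≤ b then
      quadrantCount n (a - 1) b + quadrantCount n (a + 1) b +
        quadrantCount n (a - 1) (b - 1) + quadrantCount n (a + 1) (b + 1) else 0 := by
  have h : ((a - b, b) : ℤ × ℤ) ∈ coneG ↔ 0 ≤ a ∧ 0 ≤ b := by simp [coneG]
  simp only [quadrantCount, card_coneWalks_succ, h]
  split_ifs with hab
  · rw [stepFinset, Finset.sum_insert (by simp), Finset.sum_insert (by simp),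
      Finset.sum_insert (by simp), Finset.sum_singleton]
    push_cast
    simp only [Prod.mk_sub_mk, sub_zero, sub_neg_eq_add]
    ring_nf
  · simp

lemma quadrantCount_eq_zero_of_neg (n : ℕ) {a b : ℤ} (h : a < 0 ∨ b < 0) :
    quadrantCount n a b = 0 := by
  cases n with
  | zero => rw [quadrantCount_zero, if_neg (by omega)]
  | succ n => rw [quadrantCount_succ, if_neg (by omega)]

lemma quadrantCount_eq_zero_of_lt (n : ℕ) {a b : ℤ} (h : (n : ℤ) < a ∨ (n : ℤ) < b) :
    quadrantCount n a b = 0 := by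
  induction n generalizing a b with
  | zero => rw [quadrantCount_zero, if_neg (by push_cast at h; omega)]
  | succ n ih =>
    push_cast at h
    rw [quadrantCount_succ, ih (by omega), ih (by omega), ih (by omega), ih (by omega)]
    simp

open Polynomial in
/-- The polynomial `∑ quadrantCount n a b x^a y^b`, with `y` the outer variable. -/
noncomputable def endpointPoly (n : ℕ) : ℚ[X][X] :=
  ∑ b ∈ Finset.range (n + 1), monomial b
    (∑ a ∈ Finset.range (n + 1), monomial a (quadrantCount n a b))

lemma coeff_coeff_endpointPoly (n a b : ℕ) :
    ((endpointPoly n).coeff b).coeff a = quadrantCount n a b := by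
  rw [endpointPoly, Polynomial.finsetSum_coeff]
  simp_rw [Polynomial.coeff_monomial]
  rw [Finset.sum_ite_eq']
  split_ifs with hb
  · simp only [Polynomial.finsetSum_coeff, Polynomial.coeff_monomial]
    rw [Finset.sum_ite_eq']
    split_ifs with ha
    · rfl
    · rw [quadrantCount_eq_zero_of_lt]
      simp only [Finset.mem_range] at ha
      omega
  · rw [quadrantCount_eq_zero_of_lt, Polynomial.coeff_zero]
    simp only [Finset.mem_range] at hb
    omega

open Polynomial in
/-- The walks ending on the axis `a = 0`, counted by their ordinate. -/
noncomputable def verticalPoly (n : ℕ) : ℚ[X] := (endpointPoly n).map (evalRingHom 0)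

lemma coeff_verticalPoly (n b : ℕ) : (verticalPoly n).coeff b = quadrantCount n 0 b := by
  rw [verticalPoly, Polynomial.coeff_map, Polynomial.coe_evalRingHom,
    ← Polynomial.coeff_zero_eq_eval_zero, coeff_coeff_endpointPoly]
  rfl

lemma endpointPoly_zero : endpointPoly 0 = 1 := by
  simp [endpointPoly, quadrantCount_zero]

open Polynomial in
lemma endpointPoly_succ (n : ℕ) :
    C X * X * endpointPoly (n + 1) = (1 + X) * (1 + C X ^ 2 * X) * endpointPoly n
      - (1 + X) * (verticalPoly n).map C - C X * C ((endpointPoly n).coeff 0).divX := by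
  have h : ((endpointPoly n).coeff 0) =
      X * ((endpointPoly n).coeff 0).divX + C (quadrantCount n 0 0) := by
    conv_lhs => rw [← X_mul_divX_add ((endpointPoly n).coeff 0)]
    rw [coeff_coeff_endpointPoly]
    rfl
  have h' : C X * C ((endpointPoly n).coeff 0).divX =
      C ((endpointPoly n).coeff 0) - C (C (quadrantCount n 0 0)) := by
    rw [← C_mul, ← C_sub]
    conv_rhs => rw [h]
    ring_nf
  rw [h']
  rw [show C X * X * endpointPoly (n + 1) = X * (C X * endpointPoly (n + 1)) by ring,
    show (1 + X) * (1 + C X ^ 2 * X) * endpointPoly n = endpointPoly n + X * endpointPoly n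
      + X * (C X * (C X * endpointPoly n)) + X * (X * (C X * (C X * endpointPoly n))) by ring,
    add_mul, one_mul]
  have hneg : ∀ a b : ℤ, (a < 0 ∨ b < 0) → quadrantCount n a b = 0 := fun a b h =>
    quadrantCount_eq_zero_of_neg n h
  have hc : ∀ a b : ℕ, ((endpointPoly (n + 1)).coeff b).coeff a =
      quadrantCount n (a - 1) b + quadrantCount n (a + 1) b +
        quadrantCount n (a - 1) (b - 1) + quadrantCount n (a + 1) (b + 1) := by
    intro a b
    rw [coeff_coeff_endpointPoly, quadrantCount_succ, if_pos (by omega)]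
  ext b a
  rcases b with _ | _ | b <;> rcases a with _ | _ | a <;>
    simp [coeff_X_mul, coeff_C_mul, coeff_C_succ, coeff_verticalPoly, coeff_coeff_endpointPoly, hc,
      coeff_C, hneg] <;> ring_nf

section KernelRing

open Polynomial

/-- The embedding of series in `t` over `ℚ[x]` into series over `ℚ[x][y]`. -/
noncomputable def embX : PowerSeries ℚ[X] →+* PowerSeries ℚ[X][X] :=
  PowerSeries.map (C : ℚ[X] →+* ℚ[X][X])

/-- The embedding of series in `t` over `ℚ[y]` into series over `ℚ[x][y]`. -/
noncomputable def embY : PowerSeries ℚ[X] →+* PowerSeries ℚ[X][X] :=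
  PowerSeries.map (mapRingHom (C : ℚ →+* ℚ[X]))

/-- Specialisation `x = 0`. -/
noncomputable def zeroX : PowerSeries ℚ[X][X] →+* PowerSeries ℚ[X] :=
  PowerSeries.map (mapRingHom (evalRingHom (0 : ℚ)))

/-- Specialisation `y = 0`. -/
noncomputable def zeroY : PowerSeries ℚ[X][X] →+* PowerSeries ℚ[X] :=
  PowerSeries.map (evalRingHom (0 : ℚ[X]))

/-- The embedding of series in `t` over `ℚ` into series over `ℚ[x]`. -/
noncomputable def embC : PowerSeries ℚ →+* PowerSeries ℚ[X] := PowerSeries.map (C : ℚ →+* ℚ[X])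

/-- Specialisation of the polynomial variable at a rational number. -/
noncomputable def evalAt (r : ℚ) : PowerSeries ℚ[X] →+* PowerSeries ℚ :=
  PowerSeries.map (evalRingHom r)

/-- The polynomial variable of `ℚ[X]⟦t⟧`. -/
noncomputable abbrev varX : PowerSeries ℚ[X] := PowerSeries.C X

/-- The kernel `xy - t(1 + y)(1 + x²y)` of the walk. -/
noncomputable def walkKernel : PowerSeries ℚ[X][X] :=
  embX varX * embY varX
    - PowerSeries.X * (1 + embY varX) * (1 + embX varX ^ 2 * embY varX)

lemma evalRingHom_zero_comp_C : (evalRingHom (0 : ℚ)).comp C = RingHom.id ℚ :=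
  RingHom.ext fun r => by simp

@[simp] lemma embX_X : embX PowerSeries.X = PowerSeries.X := PowerSeries.map_X _
@[simp] lemma embY_X : embY PowerSeries.X = PowerSeries.X := PowerSeries.map_X _
@[simp] lemma embC_X : embC PowerSeries.X = PowerSeries.X := PowerSeries.map_X _
@[simp] lemma zeroX_X : zeroX PowerSeries.X = PowerSeries.X := PowerSeries.map_X _
@[simp] lemma zeroY_X : zeroY PowerSeries.X = PowerSeries.X := PowerSeries.map_X _
@[simp] lemma evalAt_X (r : ℚ) : evalAt r PowerSeries.X = PowerSeries.X := PowerSeries.map_X _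

@[simp] lemma evalAt_varX (r : ℚ) : evalAt r varX = PowerSeries.C r := by
  simp [evalAt]

@[simp] lemma evalAt_embC (r : ℚ) (f : PowerSeries ℚ) : evalAt r (embC f) = f := by
  ext n; simp [evalAt, embC]

lemma embX_embC (f : PowerSeries ℚ) : embX (embC f) = embY (embC f) := by
  ext n : 1; simp [embX, embY, embC]

@[simp] lemma zeroX_embX (f : PowerSeries ℚ[X]) : zeroX (embX f) = embC (evalAt 0 f) := by
  ext n : 1; simp [zeroX, embX, embC, evalAt]

@[simp] lemma zeroX_embY (f : PowerSeries ℚ[X]) : zeroX (embY f) = f := by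
  ext n : 1
  simp only [zeroX, embY, PowerSeries.coeff_map, coe_mapRingHom, map_map,
    evalRingHom_zero_comp_C, Polynomial.map_id]

@[simp] lemma zeroY_embX (f : PowerSeries ℚ[X]) : zeroY (embX f) = f := by
  ext n : 1; simp [zeroY, embX]

@[simp] lemma zeroY_embY (f : PowerSeries ℚ[X]) : zeroY (embY f) = embC (evalAt 0 f) := by
  ext n : 1
  simp [zeroY, embY, embC, evalAt, ← coeff_zero_eq_eval_zero]

lemma exists_eq_varX_mul_of_evalAt {f : PowerSeries ℚ[X]} (h : evalAt 0 f = 0) :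
    ∃ g, f = varX * g := by
  have h' : ∀ n, X ∣ PowerSeries.coeff n f := fun n => by
    rw [X_dvd_iff, coeff_zero_eq_eval_zero]
    simpa [evalAt] using congrArg (PowerSeries.coeff n) h
  choose c hc using h'
  exact ⟨PowerSeries.mk c, by ext n : 1; simp [hc]⟩

lemma exists_eq_mul_of_zeroX {f : PowerSeries ℚ[X][X]} (h : zeroX f = 0) :
    ∃ g, f = embX varX * g := by
  have h' : ∀ n, C X ∣ PowerSeries.coeff n f := fun n => by
    rw [C_dvd_iff_dvd_coeff]
    intro i
    rw [X_dvd_iff, coeff_zero_eq_eval_zero]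
    simpa [zeroX] using congrArg (fun s => (PowerSeries.coeff n s).coeff i) h
  choose c hc using h'
  exact ⟨PowerSeries.mk c, by ext n : 1; simp [hc, embX]⟩

lemma exists_eq_mul_of_zeroY {f : PowerSeries ℚ[X][X]} (h : zeroY f = 0) :
    ∃ g, f = embY varX * g := by
  have h' : ∀ n, X ∣ PowerSeries.coeff n f := fun n => by
    rw [X_dvd_iff, coeff_zero_eq_eval_zero]
    simpa [zeroY] using congrArg (PowerSeries.coeff n) h
  choose c hc using h'
  exact ⟨PowerSeries.mk c, by ext n : 1; simp [hc, embY]⟩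

lemma evalAt_ne_zero {f : PowerSeries ℚ[X]} (r : ℚ) (h : evalAt r f ≠ 0) : f ≠ 0 := by
  rintro rfl
  simp at h

lemma embX_varX_ne_zero : embX varX ≠ 0 := by
  intro h
  have := congrArg zeroY h
  rw [zeroY_embX, map_zero] at this
  exact evalAt_ne_zero 1 (by simp) this

lemma embY_varX_ne_zero : embY varX ≠ 0 := by
  intro h
  have := congrArg zeroX h
  rw [zeroX_embY, map_zero] at this
  exact evalAt_ne_zero 1 (by simp) this

lemma walkKernel_dvd_of_dvd_embX_mul {f : PowerSeries ℚ[X][X]}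
    (h : walkKernel ∣ embX varX * f) : walkKernel ∣ f := by
  obtain ⟨g, hg⟩ := h
  have h0 := congrArg zeroX hg
  have hne : zeroX walkKernel ≠ 0 := by
    refine evalAt_ne_zero 0 ?_
    simp [walkKernel, PowerSeries.X_ne_zero]
  have hz : zeroX g = 0 := by
    simp only [map_mul, zeroX_embX, evalAt_varX, map_zero, zero_mul] at h0
    exact (mul_eq_zero.1 h0.symm).resolve_left hne
  obtain ⟨g', rfl⟩ := exists_eq_mul_of_zeroX hz
  exact ⟨g', mul_left_cancel₀ embX_varX_ne_zero (by rw [hg]; ring)⟩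

lemma walkKernel_dvd_of_dvd_embY_mul {f : PowerSeries ℚ[X][X]}
    (h : walkKernel ∣ embY varX * f) : walkKernel ∣ f := by
  obtain ⟨g, hg⟩ := h
  have h0 := congrArg zeroY hg
  have hne : zeroY walkKernel ≠ 0 := by
    refine evalAt_ne_zero 0 ?_
    simp [walkKernel, PowerSeries.X_ne_zero]
  have hz : zeroY g = 0 := by
    simp only [map_mul, zeroY_embY, evalAt_varX, map_zero, zero_mul] at h0
    exact (mul_eq_zero.1 h0.symm).resolve_left hne
  obtain ⟨g', rfl⟩ := exists_eq_mul_of_zeroY hz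
  exact ⟨g', mul_left_cancel₀ embY_varX_ne_zero (by rw [hg]; ring)⟩

/-- A series in `x` and a series in `y` that agree (up to the unit `(1 + y)³`) modulo the kernel
are both constant. -/
lemma eq_zero_of_walkKernel_dvd {w v : PowerSeries ℚ[X]}
    (h : walkKernel ∣ (1 + embY varX) ^ 3 * (embX varX * embX w) - embY v) : w = 0 ∧ v = 0 := by
  obtain ⟨g, hg⟩ := h
  have key : ∀ n, PowerSeries.coeff n w = 0 ∧ PowerSeries.coeff n v = 0 ∧
      PowerSeries.coeff n g = 0 := by
    intro n
    induction n using Nat.strong_induction_on with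
    | _ n ih =>
    have hn : (1 + X) ^ 3 * (C X * C (PowerSeries.coeff n w))
        - (PowerSeries.coeff n v).map C = C X * X * PowerSeries.coeff n g := by
      have h0 := congrArg (PowerSeries.coeff n) hg
      have hX : PowerSeries.coeff n (PowerSeries.X *
          (PowerSeries.C ((1 + X) * (1 + C X ^ 2 * X)) * g)) = 0 := by
        cases n with
        | zero => simp
        | succ n =>
          rw [PowerSeries.coeff_succ_X_mul, PowerSeries.coeff_C_mul, (ih n n.lt_succ_self).2.2,
            mul_zero]
      have hk : walkKernel * g = PowerSeries.C (C X * X) * g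
          - PowerSeries.X * (PowerSeries.C ((1 + X) * (1 + C X ^ 2 * X)) * g) := by
        simp [walkKernel, embX, embY]
        ring
      have hw : (1 + embY varX) ^ 3 * (embX varX * embX w)
          = PowerSeries.C ((1 + X) ^ 3 * C X) * embX w := by
        simp [embX, embY]
        ring
      rw [hk, hw, map_sub, map_sub, hX, PowerSeries.coeff_C_mul, PowerSeries.coeff_C_mul,
        sub_zero] at h0
      simpa [embX, embY, mul_assoc] using h0
    have hv : PowerSeries.coeff n v = 0 := by
      have h1 := congrArg (Polynomial.map (evalRingHom (0 : ℚ))) hn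
      have h2 : ((PowerSeries.coeff n v).map C).map (evalRingHom (0 : ℚ))
          = PowerSeries.coeff n v := by
        rw [map_map, evalRingHom_zero_comp_C, Polynomial.map_id]
      simpa [h2] using h1
    have hw : PowerSeries.coeff n w = 0 := by
      have h1 := congrArg (Polynomial.eval (0 : ℚ[X])) hn
      simpa [hv] using h1
    refine ⟨hw, hv, ?_⟩
    simpa [hv, hw] using hn.symm
  exact ⟨by ext n : 1; exact (key n).1, by ext n : 1; exact (key n).2.1⟩

lemma dvd_of_invariant_relations {A : Type*} [CommRing A] {t x y u v d q k H W V : A}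
    (hk : k = x * y - t * (1 + y) * (1 + x ^ 2 * y))
    (hlin : t * (1 + y) * u - x * v = -(k * H))
    (hI : (x + x ^ 3 - t * (1 + x ^ 2) ^ 2 + t * u ^ 2 - x * u) * (u + t * q * x)
      - d * x ^ 2 * u = x ^ 3 * W)
    (hJ : (t ^ 2 * (1 - y ^ 2) ^ 2 + y ^ 2 + y * v ^ 2 - y * (1 + y) * v)
      * (v + t ^ 2 * q * (1 + y)) - d * t * v * y * (1 + y) ^ 2 = y * V) :
    k ∣ y * (x * (x * (x * ((1 + y) ^ 3 * (t ^ 2 * W) - V)))) := by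
  refine ⟨(-H * (y * (t * (1 + y) * u + x * v) - (1 + y) * y * x)
      + (-(x * y) + t * (1 + y) * (y + x ^ 2))) * (t * (1 + y) * (u + t * q * x))
    - x ^ 2 * (t ^ 2 * (1 - y ^ 2) ^ 2 + y ^ 2 + y * v ^ 2 - y * (1 + y) * v) * H
    + d * t * y * (1 + y) ^ 2 * x ^ 2 * H, ?_⟩
  linear_combination -(t ^ 2 * (1 + y) ^ 3 * y) * hI + x ^ 3 * hJ
    + ((y * (t * (1 + y) * u + x * v) - (1 + y) * y * x) * (t * (1 + y) * (u + t * q * x))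
      + x ^ 2 * (t ^ 2 * (1 - y ^ 2) ^ 2 + y ^ 2 + y * v ^ 2 - y * (1 + y) * v)
      - d * t * y * (1 + y) ^ 2 * x ^ 2) * hlin
    - (-(x * y) + t * (1 + y) * (y + x ^ 2)) * (t * (1 + y) * (u + t * q * x)) * hk

/-- The two invariants of the walk model: a cubic equation for the series `R` of walks ending on
the horizontal axis and one for the series `s` of walks ending on the vertical axis. -/
lemma exists_cubic_equations {F : PowerSeries ℚ[X][X]} {R s : PowerSeries ℚ[X]}
    (h : walkKernel * F = embX varX * embY varX
      - PowerSeries.X * (1 + embY varX) * embY s - embX varX * embX R)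
    {q : PowerSeries ℚ} (hq : evalAt 0 s = q) {t x u v : PowerSeries ℚ[X]}
    (ht : t = PowerSeries.X) (hx : x = varX)
    (hu : u = 1 + x ^ 2 * R) (hv : v = x - t ^ 2 * (1 + x) ^ 2 * s) :
    ∃ d e : PowerSeries ℚ,
      (x + x ^ 3 - t * (1 + x ^ 2) ^ 2 + t * u ^ 2 - x * u) * (u + t * embC q * x)
          - embC d * x ^ 2 * u = x ^ 3 * embC e ∧
      (t ^ 2 * (1 - x ^ 2) ^ 2 + x ^ 2 + x * v ^ 2 - x * (1 + x) * v)
          * (v + t ^ 2 * embC q * (1 + x)) - embC d * t * v * x * (1 + x) ^ 2 =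
        t ^ 2 * x * (1 + x) ^ 3 * embC e := by
  obtain ⟨R₂, hR₂⟩ := exists_eq_varX_mul_of_evalAt
    (f := R - embC (evalAt 0 R)) (by simp)
  obtain ⟨s₁, hs₁⟩ := exists_eq_varX_mul_of_evalAt
    (f := s - embC q) (by simp [hq])
  generalize evalAt 0 R = r at hR₂
  rw [← hx] at hR₂ hs₁
  have hR : R = embC r + x * R₂ := by linear_combination hR₂
  have hs : s = embC q + x * s₁ := by linear_combination hs₁
  obtain ⟨d, hd⟩ : ∃ d, d = -2 * PowerSeries.X + 2 * PowerSeries.X * r := ⟨_, rfl⟩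
  have hd' : embC d = -2 * t + 2 * t * embC r := by simp [hd, ht, map_ofNat]
  obtain ⟨W, hW⟩ : ∃ W, W = (1 - t * x + 2 * t * R₂ + t * x * R ^ 2 - R)
      * (1 + x ^ 2 * R + t * embC q * x) + embC d * t * embC q := ⟨_, rfl⟩
  obtain ⟨V, hV⟩ : ∃ V, V = (t ^ 2 * (1 - x ^ 2) ^ 2 + x ^ 2 + x * v ^ 2 - x * (1 + x) * v)
      * (1 - t ^ 2 * (1 + x) * (embC q + (1 + x) * s₁)) - embC d * t * v * (1 + x) ^ 2 := ⟨_, rfl⟩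
  have hI : (x + x ^ 3 - t * (1 + x ^ 2) ^ 2 + t * u ^ 2 - x * u) * (u + t * embC q * x)
      - embC d * x ^ 2 * u = x ^ 3 * W := by
    rw [hW, hd', hu, hR]; ring
  have hJ : (t ^ 2 * (1 - x ^ 2) ^ 2 + x ^ 2 + x * v ^ 2 - x * (1 + x) * v)
      * (v + t ^ 2 * embC q * (1 + x)) - embC d * t * v * x * (1 + x) ^ 2 = x * V := by
    have hvq : v + t ^ 2 * embC q * (1 + x) =
        x * (1 - t ^ 2 * (1 + x) * (embC q + (1 + x) * s₁)) := by
      rw [hv, hs]; ring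
    rw [hV, hvq]; ring
  have hdvd : walkKernel ∣ (1 + embY x) ^ 3 * embX (t ^ 2 * W) - embY V := by
    rw [← hx] at h
    have hk : walkKernel = embX x * embY x
        - PowerSeries.X * (1 + embY x) * (1 + embX x ^ 2 * embY x) := by rw [hx]; rfl
    refine walkKernel_dvd_of_dvd_embX_mul (walkKernel_dvd_of_dvd_embX_mul
      (walkKernel_dvd_of_dvd_embX_mul (walkKernel_dvd_of_dvd_embY_mul ?_)))
    rw [← hx]
    have hI' := congrArg embX hI
    have hJ' := congrArg embY hJ
    have hu' := congrArg embX hu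
    have hv' := congrArg embY hv
    simp only [map_add, map_sub, map_mul, map_pow, map_one, ht, embX_X, embY_X, embX_embC]
      at hI' hJ' hu' hv' ⊢
    have hlin : PowerSeries.X * (1 + embY x) * embX u - embX x * embY v
        = -(walkKernel * (1 + PowerSeries.X * (1 + embY x) * embX x * F)) := by
      rw [hu', hv']
      linear_combination PowerSeries.X * (1 + embY x) * embX x * h + hk
    exact dvd_of_invariant_relations hk hlin hI' hJ'
  obtain ⟨w, hw⟩ := exists_eq_varX_mul_of_evalAt
    (f := t ^ 2 * W - t ^ 2 * embC (evalAt 0 W)) (by simp [ht])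
  obtain ⟨hw0, hV0⟩ := eq_zero_of_walkKernel_dvd (w := w)
      (v := V - (1 + x) ^ 3 * (t ^ 2 * embC (evalAt 0 W))) <| by
    convert hdvd using 1
    rw [show t ^ 2 * W = t ^ 2 * embC (evalAt 0 W) + varX * w by linear_combination hw]
    simp only [map_add, map_sub, map_mul, map_pow, map_one, ht, embX_X, embY_X, embX_embC]
    rw [hx]
    ring
  have ht0 : t ^ 2 ≠ 0 := by rw [ht]; exact pow_ne_zero 2 PowerSeries.X_ne_zero
  have hWe : W = embC (evalAt 0 W) := by
    refine mul_left_cancel₀ ht0 ?_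
    rw [hw0, mul_zero] at hw
    exact sub_eq_zero.1 hw
  refine ⟨d, evalAt 0 W, ?_, ?_⟩
  · rw [hI, ← hWe]
  · rw [hJ, sub_eq_zero.1 hV0]
    ring

/-- The coefficientwise derivative with respect to the polynomial variable. -/
noncomputable def derivX : Derivation ℚ (PowerSeries ℚ[X]) (PowerSeries ℚ[X]) :=
  Derivation.mk'
    { toFun := fun f => PowerSeries.mk fun n => derivative (PowerSeries.coeff n f)
      map_add' := fun f g => by ext n : 1; simp
      map_smul' := fun c f => by ext n : 1; simp }
    fun f g => by
      ext n : 1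
      simp only [LinearMap.coe_mk, AddHom.coe_mk, PowerSeries.coeff_mk, PowerSeries.coeff_mul,
        derivative_sum, derivative_mul, Finset.sum_add_distrib, smul_eq_mul, map_add]
      rw [add_comm]
      congr 1
      rw [← Finset.Nat.sum_antidiagonal_swap]
      simp [mul_comm]

lemma coeff_derivX (f : PowerSeries ℚ[X]) (n : ℕ) :
    PowerSeries.coeff n (derivX f) = derivative (PowerSeries.coeff n f) := by
  simp [derivX]

@[simp] lemma derivX_X : derivX PowerSeries.X = 0 := by
  ext n : 1
  rw [coeff_derivX, PowerSeries.coeff_X]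
  split_ifs <;> simp

@[simp] lemma derivX_varX : derivX varX = 1 := by
  ext n : 1
  rw [coeff_derivX, PowerSeries.coeff_C, PowerSeries.coeff_one]
  split_ifs <;> simp

@[simp] lemma derivX_embC (f : PowerSeries ℚ) : derivX (embC f) = 0 := by
  ext n : 1
  simp [coeff_derivX, embC]

/-- The number of excursions satisfies a polynomial equation through an auxiliary series `g`. -/
lemma exists_algebraic_equations {F : PowerSeries ℚ[X][X]} {R s : PowerSeries ℚ[X]}
    (h : walkKernel * F = embX varX * embY varX
      - PowerSeries.X * (1 + embY varX) * embY s - embX varX * embX R)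
    (hR : PowerSeries.X ∣ R) {q : PowerSeries ℚ} (hq : evalAt 0 s = q) :
    ∃ g : PowerSeries ℚ, PowerSeries.constantCoeff g = 1 ∧
      g * (1 + 2 * PowerSeries.X ^ 2 * q) = 1 + 3 * PowerSeries.X ^ 2 * g ^ 4 ∧
      27 * PowerSeries.X ^ 4 * g ^ 8 - 18 * PowerSeries.X ^ 2 * g ^ 4 - 1
        + g ^ 2 * (1 + 16 * PowerSeries.X ^ 2) = 0 := by
  obtain ⟨R₁, rfl⟩ := hR
  obtain ⟨t, ht⟩ : ∃ t : PowerSeries ℚ[X], t = PowerSeries.X := ⟨_, rfl⟩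
  obtain ⟨x, hx⟩ : ∃ x, x = varX := ⟨_, rfl⟩
  obtain ⟨u, hu⟩ : ∃ u, u = 1 + x ^ 2 * (t * R₁) := ⟨_, rfl⟩
  obtain ⟨v, hv⟩ : ∃ v, v = x - t ^ 2 * (1 + x) ^ 2 * s := ⟨_, rfl⟩
  obtain ⟨d, e, hI, hJ⟩ := exists_cubic_equations h hq ht hx (hu.trans (by rw [ht])) hv
  have hDx : derivX x = 1 := by rw [hx, derivX_varX]
  have hDt : derivX t = 0 := by rw [ht, derivX_X]
  have hD : ∀ a b, derivX (a * b) = a * derivX b + b * derivX a := fun a b => by simp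
  have hpow : ∀ (a : PowerSeries ℚ[X]) (n : ℕ), derivX (a ^ n) = n * a ^ (n - 1) * derivX a :=
    fun a n => by simp [Derivation.leibniz_pow, mul_assoc]
  have hI' := congrArg derivX hI
  have hJ' := congrArg derivX hJ
  have hu' := congrArg derivX hu
  have hv' := congrArg derivX hv
  simp only [map_add, map_sub, hD, hpow, hDx, hDt, derivX_embC, Derivation.map_one_eq_zero]
    at hI' hJ' hu' hv'
  have hxe : ∀ r, evalAt r x = PowerSeries.C r := fun r => by rw [hx, evalAt_varX]
  have hte : ∀ r, evalAt r t = PowerSeries.X := fun r => by rw [ht, evalAt_X]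
  have hne : ∀ {f : PowerSeries ℚ}, PowerSeries.constantCoeff f ≠ 0 → f ≠ 0 := by
    rintro f hf rfl
    simp at hf
  have a₀ := congrArg (evalAt 1) hI
  have a₁ := congrArg (evalAt 1) hI'
  have a₂ := congrArg (evalAt 1) hu
  have a₃ := congrArg (evalAt 1) hu'
  have b₀ := congrArg (evalAt (-1)) hI
  have b₁ := congrArg (evalAt (-1)) hI'
  have b₂ := congrArg (evalAt (-1)) hu
  have b₃ := congrArg (evalAt (-1)) hu'
  have c₀ := congrArg (evalAt 1) hJ
  have c₁ := congrArg (evalAt 1) hJ'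
  have c₂ := congrArg (evalAt 1) hv
  have c₃ := congrArg (evalAt 1) hv'
  simp only [map_add, map_sub, map_mul, map_pow, map_one, map_neg, map_zero, map_natCast, hxe, hte,
    evalAt_embC] at a₀ a₁ a₂ a₃ b₀ b₁ b₂ b₃ c₀ c₁ c₂ c₃
  push_cast at a₁ a₃ b₁ b₃ c₁ c₃
  have a₄ := congrArg PowerSeries.constantCoeff a₂
  have a₅ := congrArg PowerSeries.constantCoeff a₃
  have b₄ := congrArg PowerSeries.constantCoeff b₂
  have b₅ := congrArg PowerSeries.constantCoeff b₃
  have c₄ := congrArg PowerSeries.constantCoeff c₂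
  have c₅ := congrArg PowerSeries.constantCoeff c₃
  simp at a₄ a₅ b₄ b₅ c₄ c₅
  clear a₂ a₃ b₂ b₃ c₂ c₃
  generalize evalAt 1 (derivX u) = α' at *
  generalize evalAt 1 u = α at *
  generalize evalAt (-1) (derivX u) = β' at *
  generalize evalAt (-1) u = β at *
  generalize evalAt 1 (derivX v) = γ' at *
  generalize evalAt 1 v = γ at *
  have : CharZero (PowerSeries ℚ) := algebraRat.charZero _
  have hg : 2 * (PowerSeries.C (1 / 2) * (α - -β)) = α - -β := by
    rw [← mul_assoc, show (2 : PowerSeries ℚ) = PowerSeries.C 2 by rw [map_ofNat], ← map_mul]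
    norm_num
  refine ⟨PowerSeries.C (1 / 2) * (α - -β), ?_, critical_elimination (d := d) (e := e) (β := -β) (γ := γ)
    (hne ?_) (hne ?_) (hne ?_) ?_ ?_ ?_ ?_ ?_ ?_ _ hg⟩
  · simp [a₄, b₄]; norm_num
  · simp [a₄, b₄]
  · simp [a₄, c₄]
  · simp [c₄]
  · linear_combination a₀
  · refine mul_left_cancel₀ (hne (f := α' - α) ?_) ?_
    · simp [a₄, a₅]
    · linear_combination a₁ - 3 * a₀
  · linear_combination -b₀
  · refine mul_left_cancel₀ (hne (f := β' - -β) ?_) ?_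
    · simp [b₄, b₅]
    · linear_combination b₁ + 3 * b₀
  · linear_combination c₀
  · refine mul_left_cancel₀ (hne (f := 2 * γ' - γ) ?_) ?_
    · simp only [map_sub, map_mul, map_ofNat, c₄, c₅]; norm_num
    · linear_combination 2 * c₁ - 5 * c₀

/-- The functional equation of the generating series of quadrant walks. -/
lemma walkKernel_mul_mk_endpointPoly :
    walkKernel * PowerSeries.mk endpointPoly = embX varX * embY varX
      - PowerSeries.X * (1 + embY varX) * embY (PowerSeries.mk verticalPoly)
      - embX varX * embX (PowerSeries.X *
          PowerSeries.mk fun n => ((endpointPoly n).coeff 0).divX) := by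
  have hk : ∀ f, walkKernel * f = PowerSeries.C (C X * X) * f
      - PowerSeries.X * (PowerSeries.C ((1 + X) * (1 + C X ^ 2 * X)) * f) := fun f => by
    simp [walkKernel, embX, embY]
    ring
  have hx : embX varX = PowerSeries.C (C X) := by simp [embX]
  have hy : embY varX = PowerSeries.C X := by simp [embY]
  have hy' : (1 : PowerSeries ℚ[X][X]) + PowerSeries.C X = PowerSeries.C (1 + X) := by simp
  rw [hk, hx, hy, hy', ← map_mul, map_mul embX, embX_X, mul_assoc PowerSeries.X,
    mul_left_comm (PowerSeries.C (C X : ℚ[X][X]))]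
  ext n : 1
  cases n with
  | zero => simp [endpointPoly_zero]
  | succ n =>
    simp only [map_sub, PowerSeries.coeff_succ_X_mul, PowerSeries.coeff_C_mul,
      PowerSeries.coeff_succ_C, PowerSeries.coeff_mk, embX, embY, PowerSeries.coeff_map,
      coe_mapRingHom]
    linear_combination endpointPoly_succ n

end KernelRing

lemma quadrantCount_recurrence (k : ℕ) :
    ((k : ℚ) + 2) * (k + 5 / 3) * quadrantCount (2 * (k + 1)) 0 0 =
      16 * (k + 1 / 2) * (k + 5 / 6) * quadrantCount (2 * k) 0 0 := by
  obtain ⟨g, hg, h₁, h₂⟩ := exists_algebraic_equations walkKernel_mul_mk_endpointPoly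
    (dvd_mul_right _ _) (q := PowerSeries.mk fun n => quadrantCount n 0 0) (by
      ext n
      simp [evalAt, ← Polynomial.coeff_zero_eq_eval_zero, coeff_verticalPoly])
  simpa using coeff_recurrence_of_algebraic hg h₁ h₂ k

lemma poch_succ (a : ℚ) (n : ℕ) : poch a (n + 1) = poch a n * (a + n) :=
  ascPochhammer_succ_eval n a

lemma poch_pos {a : ℚ} (ha : 0 < a) (n : ℕ) : 0 < poch a n := ascPochhammer_pos n a ha

theorem gessel_excursion_count (n : ℕ) :
    (walkCount squareSteps coneG (0, 0) (0, 0) (2*n) : ℚ) =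
      16^n * (poch (1/2) n * poch (5/6) n) / (poch 2 n * poch (5/3) n) := by
  have hcount : (walkCount squareSteps coneG (0, 0) (0, 0) (2 * n) : ℚ) =
      quadrantCount (2 * n) 0 0 := by
    rw [walkCount_eq_card]
    rfl
  have h2 (m : ℕ) : poch 2 m ≠ 0 := (poch_pos two_pos m).ne'
  have h53 (m : ℕ) : poch (5 / 3) m ≠ 0 := (poch_pos (by norm_num) m).ne'
  rw [hcount, eq_div_iff (mul_ne_zero (h2 n) (h53 n))]
  clear hcount
  induction n with
  | zero => simp [poch, quadrantCount_zero]
  | succ n ih =>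
    simp only [poch_succ]
    linear_combination poch 2 n * poch (5 / 3) n * quadrantCount_recurrence n
      + 16 * (n + 1 / 2) * (n + 5 / 6) * ih
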